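/- For each q ∈ (0,1) and each γ ≥ 1, the limit lim_{N→∞} (1/N) 𝔼[G(⌊γN⌋, N)] exists and equals ω(γ,q) = (1+√(qγ))²/(1−q) − 1. -/

import Mathlib

open MeasureTheory Filter

/-- An up/right path from `(1,1)` to `(M,N)`: a sequence of `M+N-1` lattice sites starting at
`(1,1)`, ending at `(M,N)`, each step increasing one coordinate by one. -/
def UpRightPath (M N : ℕ) (π : ℕ → ℕ × ℕ) : Prop :=
  π 0 = (1, 1) ∧ π (M + N - 2) = (M, N) ∧
    ∀ k, k < M + N - 2 →
      π (k + 1) = ((π k).1 + 1, (π k).2) ∨ π (k + 1) = ((π k).1, (π k).2 + 1)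

/-- `G(M,N)`: the maximum over up/right paths from `(1,1)` to `(M,N)` of the sum of the
site weights `w` along the path. -/
noncomputable def lppSup (w : ℕ × ℕ → ℕ) (M N : ℕ) : ℕ :=
  sSup {s | ∃ π : ℕ → ℕ × ℕ, UpRightPath M N π ∧
    s = ∑ k ∈ Finset.range (M + N - 1), w (π k)}

/-! ### Last passage times by recursion -/

/-- Last passage time from `(0,0)` to `(i,j)`, ignoring the weight at the origin, defined through
its recursion. -/
def lastPassage (x : ℕ × ℕ → ℕ) : ℕ → ℕ → ℕ
  | 0, 0 => 0
  | i + 1, 0 => lastPassage x i 0 + x (i + 1, 0)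
  | 0, j + 1 => lastPassage x 0 j + x (0, j + 1)
  | i + 1, j + 1 => max (lastPassage x i (j + 1)) (lastPassage x (i + 1) j) + x (i + 1, j + 1)

/-- The weights with those on the two coordinate axes replaced by `0`. -/
def interiorWeight (x : ℕ × ℕ → ℕ) (p : ℕ × ℕ) : ℕ :=
  if p.1 = 0 ∨ p.2 = 0 then 0 else x p

lemma lastPassage_congr {x y : ℕ × ℕ → ℕ} (M N : ℕ)
    (h : ∀ i ≤ M, ∀ j ≤ N, x (i, j) = y (i, j)) :
    ∀ i ≤ M, ∀ j ≤ N, lastPassage x i j = lastPassage y i j := by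
  intro i
  induction i with
  | zero =>
    intro _ j
    induction j with
    | zero => intro _; simp [lastPassage]
    | succ j ih => intro hj; simp [lastPassage, ih (by omega), h 0 (by omega) (j + 1) hj]
  | succ i ihi =>
    intro hi j
    induction j with
    | zero => intro _; simp [lastPassage, ihi (by omega) 0 (by omega), h (i + 1) hi 0 (by omega)]
    | succ j ih =>
      intro hj
      simp [lastPassage, ih (by omega), ihi (by omega) (j + 1) hj, h (i + 1) hi (j + 1) hj]

lemma lastPassage_mono {x y : ℕ × ℕ → ℕ} (h : ∀ p, x p ≤ y p) (i j : ℕ) :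
    lastPassage x i j ≤ lastPassage y i j := by
  induction i generalizing j with
  | zero =>
    induction j with
    | zero => simp [lastPassage]
    | succ j ih => simpa [lastPassage] using add_le_add ih (h _)
  | succ i ihi =>
    induction j with
    | zero => simpa [lastPassage] using add_le_add (ihi 0) (h _)
    | succ j ih =>
      simp only [lastPassage]
      exact add_le_add (max_le_max (ihi _) ih) (h _)

lemma lastPassage_zero_right (x : ℕ × ℕ → ℕ) (i : ℕ) :
    lastPassage x i 0 = ∑ k ∈ Finset.range i, x (k + 1, 0) := by
  induction i with
  | zero => simp [lastPassage]
  | succ i ih => simp [lastPassage, ih, Finset.sum_range_succ]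

lemma lastPassage_zero_left (x : ℕ × ℕ → ℕ) (j : ℕ) :
    lastPassage x 0 j = ∑ k ∈ Finset.range j, x (0, k + 1) := by
  induction j with
  | zero => simp [lastPassage]
  | succ i ih => simp [lastPassage, ih, Finset.sum_range_succ]

lemma interiorWeight_le (x : ℕ × ℕ → ℕ) (p : ℕ × ℕ) : interiorWeight x p ≤ x p := by
  unfold interiorWeight; split_ifs <;> simp

lemma lastPassage_interiorWeight_zero_right (x : ℕ × ℕ → ℕ) (i : ℕ) :
    lastPassage (interiorWeight x) i 0 = 0 := by
  simp [lastPassage_zero_right, interiorWeight]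

lemma lastPassage_interiorWeight_zero_left (x : ℕ × ℕ → ℕ) (j : ℕ) :
    lastPassage (interiorWeight x) 0 j = 0 := by
  simp [lastPassage_zero_left, interiorWeight]

lemma lastPassage_interiorWeight_succ (x : ℕ × ℕ → ℕ) (i j : ℕ) :
    lastPassage (interiorWeight x) (i + 1) (j + 1) =
      max (lastPassage (interiorWeight x) i (j + 1)) (lastPassage (interiorWeight x) (i + 1) j)
        + x (i + 1, j + 1) := by
  simp [lastPassage, interiorWeight]

/-- The weight collected by an up/right path is at most the last passage time. -/
lemma UpRightPath.sum_le (x : ℕ × ℕ → ℕ) {M N : ℕ} {π : ℕ → ℕ × ℕ} (hπ : UpRightPath M N π) :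
    ∀ k ≤ M + N - 2, ∃ a b, π k = (a + 1, b + 1) ∧
      ∑ l ∈ Finset.range (k + 1), x (π l) ≤ lastPassage (interiorWeight x) (a + 1) (b + 1) := by
  intro k
  induction k with
  | zero =>
    intro _
    refine ⟨0, 0, hπ.1, ?_⟩
    rw [lastPassage_interiorWeight_succ]
    simp [hπ.1]
  | succ k ih =>
    intro hk
    obtain ⟨a, b, hab, hs⟩ := ih (by omega)
    rw [Finset.sum_range_succ]
    rcases hπ.2.2 k (by omega) with h | h
    · refine ⟨a + 1, b, by rw [h, hab], ?_⟩
      rw [lastPassage_interiorWeight_succ, h, hab]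
      exact add_le_add (hs.trans (le_max_left _ _)) le_rfl
    · refine ⟨a, b + 1, by rw [h, hab], ?_⟩
      rw [lastPassage_interiorWeight_succ, h, hab]
      exact add_le_add (hs.trans (le_max_right _ _)) le_rfl

lemma UpRightPath.extend (x : ℕ × ℕ → ℕ) {M N : ℕ} (hM : 1 ≤ M) (hN : 1 ≤ N) {π : ℕ → ℕ × ℕ}
    (hπ : UpRightPath M N π) {M' N' : ℕ}
    (h : (M' = M + 1 ∧ N' = N) ∨ (M' = M ∧ N' = N + 1)) :
    ∃ π', UpRightPath M' N' π' ∧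
      ∑ k ∈ Finset.range (M' + N' - 1), x (π' k) =
        ∑ k ∈ Finset.range (M + N - 1), x (π k) + x (M', N') := by
  have hlen : M' + N' - 1 = M + N - 1 + 1 := by omega
  refine ⟨fun k => if k < M + N - 1 then π k else (M', N'), ⟨?_, ?_, ?_⟩, ?_⟩
  · simp only [show 0 < M + N - 1 by omega, if_true, hπ.1]
  · simp only [show ¬ (M' + N' - 2 < M + N - 1) by omega, if_false]
  · intro k hk
    simp only [show k < M + N - 1 by omega, if_true]
    by_cases hk' : k + 1 < M + N - 1
    · simp only [hk', if_true]
      exact hπ.2.2 k (by omega)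
    · simp only [hk', if_false]
      have : k = M + N - 2 := by omega
      rw [this, hπ.2.1]
      rcases h with ⟨rfl, rfl⟩ | ⟨rfl, rfl⟩ <;> simp
  · rw [hlen, Finset.sum_range_succ]
    simp only [lt_irrefl, if_false]
    congr 1
    refine Finset.sum_congr rfl fun k hk => ?_
    rw [if_pos (Finset.mem_range.1 hk)]

lemma exists_upRightPath_sum_eq (x : ℕ × ℕ → ℕ) (i j : ℕ) :
    ∃ π, UpRightPath (i + 1) (j + 1) π ∧
      lastPassage (interiorWeight x) (i + 1) (j + 1) =
        ∑ k ∈ Finset.range (i + 1 + (j + 1) - 1), x (π k) := by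
  induction i generalizing j with
  | zero =>
    induction j with
    | zero =>
      refine ⟨fun _ => (1, 1), ⟨rfl, rfl, fun k hk => by omega⟩, ?_⟩
      rw [lastPassage_interiorWeight_succ]
      simp [lastPassage_interiorWeight_zero_right, lastPassage_interiorWeight_zero_left]
    | succ j ih =>
      obtain ⟨π, hπ, hs⟩ := ih
      obtain ⟨π', hπ', hs'⟩ := hπ.extend x (by omega) (by omega)
        (M' := 0 + 1) (N' := j + 1 + 1) (Or.inr ⟨rfl, rfl⟩)
      refine ⟨π', hπ', ?_⟩
      rw [hs', ← hs, lastPassage_interiorWeight_succ, lastPassage_interiorWeight_zero_left]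
      simp
  | succ i ihi =>
    have fromLeft : ∀ j, ∃ π, UpRightPath (i + 1 + 1) (j + 1) π ∧
        lastPassage (interiorWeight x) (i + 1) (j + 1) + x (i + 1 + 1, j + 1) =
        ∑ k ∈ Finset.range (i + 1 + 1 + (j + 1) - 1), x (π k) := by
      intro j
      obtain ⟨π, hπ, hs⟩ := ihi j
      obtain ⟨π', hπ', hs'⟩ := hπ.extend x (by omega) (by omega)
        (M' := i + 1 + 1) (N' := j + 1) (Or.inl ⟨rfl, rfl⟩)
      exact ⟨π', hπ', by rw [hs', ← hs]⟩
    induction j with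
    | zero =>
      obtain ⟨π, hπ, hs⟩ := fromLeft 0
      refine ⟨π, hπ, ?_⟩
      rw [← hs, lastPassage_interiorWeight_succ, lastPassage_interiorWeight_zero_right]
      simp
    | succ j ih =>
      rw [lastPassage_interiorWeight_succ]
      rcases le_total (lastPassage (interiorWeight x) (i + 1) (j + 1 + 1))
        (lastPassage (interiorWeight x) (i + 1 + 1) (j + 1)) with hle | hle
      · obtain ⟨π, hπ, hs⟩ := ih
        obtain ⟨π', hπ', hs'⟩ := hπ.extend x (by omega) (by omega)
          (M' := i + 1 + 1) (N' := j + 1 + 1) (Or.inr ⟨rfl, rfl⟩)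
        exact ⟨π', hπ', by rw [hs', ← hs, max_eq_right hle]⟩
      · obtain ⟨π, hπ, hs⟩ := fromLeft (j + 1)
        exact ⟨π, hπ, by rw [← hs, max_eq_left hle]⟩

lemma lppSup_eq_lastPassage (x : ℕ × ℕ → ℕ) {M N : ℕ} (hM : 1 ≤ M) (hN : 1 ≤ N) :
    lppSup x M N = lastPassage (interiorWeight x) M N := by
  obtain ⟨i, rfl⟩ : ∃ i, M = i + 1 := ⟨M - 1, by omega⟩
  obtain ⟨j, rfl⟩ : ∃ j, N = j + 1 := ⟨N - 1, by omega⟩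
  refine IsGreatest.csSup_eq ⟨exists_upRightPath_sum_eq x i j, ?_⟩
  rintro s ⟨π, hπ, rfl⟩
  obtain ⟨a, b, hab, hs⟩ := hπ.sum_le x (i + 1 + (j + 1) - 2) le_rfl
  rw [hπ.2.1] at hab
  simp only [Prod.mk.injEq, add_left_inj] at hab
  rw [← hab.1, ← hab.2] at hs
  rwa [show i + 1 + (j + 1) - 2 + 1 = i + 1 + (j + 1) - 1 by omega] at hs

/-- Comparison of last passage times with different boundary weights: a path either leaves the
axes before step `K`, or collects at least the first `K` boundary weights on one of the axes. -/
lemma lastPassage_le_max {x y z : ℕ × ℕ → ℕ} (K : ℕ)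
    (hy : ∀ i, x (i, 0) ≤ y (i, 0)) (hz : ∀ j, x (0, j) ≤ z (0, j))
    (hxy : ∀ i j, x (i + 1, j + 1) = y (i + 1, j + 1))
    (hxz : ∀ i j, x (i + 1, j + 1) = z (i + 1, j + 1)) (i j : ℕ) :
    (lastPassage x i j : ℝ) ≤
      max (lastPassage (interiorWeight x) i j
          + (∑ k ∈ Finset.range K, (x (k + 1, 0) : ℝ) + ∑ k ∈ Finset.range K, (x (0, k + 1) : ℝ)))
        (max (lastPassage y i j
            - ∑ k ∈ Finset.range K, ((y (k + 1, 0) : ℝ) - x (k + 1, 0)))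
          (lastPassage z i j - ∑ k ∈ Finset.range K, ((z (0, k + 1) : ℝ) - x (0, k + 1)))) := by
  set A := ∑ k ∈ Finset.range K, (x (k + 1, 0) : ℝ)
  set B := ∑ k ∈ Finset.range K, (x (0, k + 1) : ℝ)
  have hA : 0 ≤ A := by positivity
  have hB : 0 ≤ B := by positivity
  have hright : ∀ i, (lastPassage x i 0 : ℝ) ≤ A ∨ (lastPassage x i 0 : ℝ) ≤ lastPassage y i 0
      - ∑ k ∈ Finset.range K, ((y (k + 1, 0) : ℝ) - x (k + 1, 0)) := by
    intro i
    rcases le_total i K with h | h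
    · left
      rw [lastPassage_zero_right]; push_cast
      exact Finset.sum_le_sum_of_subset_of_nonneg (by simpa using h) (by simp)
    · right
      rw [lastPassage_zero_right, lastPassage_zero_right]; push_cast
      have : ∑ k ∈ Finset.range K, ((y (k + 1, 0) : ℝ) - x (k + 1, 0)) ≤
          ∑ k ∈ Finset.range i, ((y (k + 1, 0) : ℝ) - x (k + 1, 0)) :=
        Finset.sum_le_sum_of_subset_of_nonneg (by simpa using h)
          (fun k _ _ => by simpa using hy (k + 1))
      simp only [Finset.sum_sub_distrib] at this ⊢
      linarith
  have hleft : ∀ j, (lastPassage x 0 j : ℝ) ≤ B ∨ (lastPassage x 0 j : ℝ) ≤ lastPassage z 0 j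
      - ∑ k ∈ Finset.range K, ((z (0, k + 1) : ℝ) - x (0, k + 1)) := by
    intro j
    rcases le_total j K with h | h
    · left
      rw [lastPassage_zero_left]; push_cast
      exact Finset.sum_le_sum_of_subset_of_nonneg (by simpa using h) (by simp)
    · right
      rw [lastPassage_zero_left, lastPassage_zero_left]; push_cast
      have : ∑ k ∈ Finset.range K, ((z (0, k + 1) : ℝ) - x (0, k + 1)) ≤
          ∑ k ∈ Finset.range j, ((z (0, k + 1) : ℝ) - x (0, k + 1)) :=
        Finset.sum_le_sum_of_subset_of_nonneg (by simpa using h)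
          (fun k _ _ => by simpa using hz (k + 1))
      simp only [Finset.sum_sub_distrib] at this ⊢
      linarith
  have hright' := fun i => (lastPassage_interiorWeight_zero_right x i)
  have hleft' := fun j => (lastPassage_interiorWeight_zero_left x j)
  induction i generalizing j with
  | zero =>
    rw [hleft', le_max_iff, le_max_iff]
    rcases hleft j with h | h
    · left; push_cast; linarith
    · exact Or.inr (Or.inr h)
  | succ i ihi =>
    induction j with
    | zero =>
      rw [hright', le_max_iff, le_max_iff]
      rcases hright (i + 1) with h | h
      · left; push_cast; linarith
      · exact Or.inr (Or.inl h)
    | succ j ih =>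
      rw [lastPassage_interiorWeight_succ]
      have h1 := ihi (j + 1)
      simp only [lastPassage, ← hxy, ← hxz]
      push_cast
      simp only [le_max_iff] at h1 ih ⊢
      have m1 := le_max_left (lastPassage (interiorWeight x) i (j + 1) : ℝ)
        (lastPassage (interiorWeight x) (i + 1) j)
      have m2 := le_max_right (lastPassage (interiorWeight x) i (j + 1) : ℝ)
        (lastPassage (interiorWeight x) (i + 1) j)
      have m3 := le_max_left (lastPassage y i (j + 1) : ℝ) (lastPassage y (i + 1) j)
      have m4 := le_max_right (lastPassage y i (j + 1) : ℝ) (lastPassage y (i + 1) j)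
      have m5 := le_max_left (lastPassage z i (j + 1) : ℝ) (lastPassage z (i + 1) j)
      have m6 := le_max_right (lastPassage z i (j + 1) : ℝ) (lastPassage z (i + 1) j)
      rcases max_choice (lastPassage x i (j + 1) : ℝ) (lastPassage x (i + 1) j) with h | h <;>
        rw [h]
      · rcases h1 with h1 | h1 | h1
        · left; linarith
        · right; left; linarith
        · right; right; linarith
      · rcases ih with h1 | h1 | h1
        · left; linarith
        · right; left; linarith
        · right; right; linarith

/-! ### The local update and the increments of last passage times -/

/-- The local update at the site `(i,j)`: the weights at `(i,0)` and `(0,j)` are viewed as the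
horizontal and vertical increments entering the site, and are replaced by the increments
leaving it; the weight at the site becomes the dual weight. -/
def siteUpdate (i j : ℕ) (x : ℕ × ℕ → ℕ) (p : ℕ × ℕ) : ℕ :=
  if p = (i, 0) then x (i, j) + (x (i, 0) - x (0, j))
  else if p = (0, j) then x (i, j) + (x (0, j) - x (i, 0))
  else if p = (i, j) then min (x (i, 0)) (x (0, j))
  else x p

/-- Update of the first `n` sites of the row `j + 1`. -/
def rowUpdate (j : ℕ) : ℕ → (ℕ × ℕ → ℕ) → ℕ × ℕ → ℕ
  | 0, x => x
  | n + 1, x => siteUpdate (n + 1) (j + 1) (rowUpdate j n x)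

/-- Update of the first `M` sites in each of the rows `1, …, j`. -/
def rowsUpdate (M : ℕ) : ℕ → (ℕ × ℕ → ℕ) → ℕ × ℕ → ℕ
  | 0, x => x
  | j + 1, x => rowUpdate j M (rowsUpdate M j x)

lemma siteUpdate_involutive (i j : ℕ) : Function.Involutive (siteUpdate (i + 1) (j + 1)) := by
  intro x
  funext p
  simp only [siteUpdate, Prod.mk.injEq]
  split_ifs <;> simp_all <;> omega

lemma rowUpdate_spec (x y : ℕ × ℕ → ℕ) (M j n : ℕ) (hn : n ≤ M)
    (h1 : ∀ i < M, lastPassage x (i + 1) j = lastPassage x i j + y (i + 1, 0))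
    (h2 : ∀ j' ≥ j, y (0, j' + 1) = x (0, j' + 1))
    (h3 : ∀ i, ∀ j' ≥ j, y (i + 1, j' + 1) = x (i + 1, j' + 1)) :
    (∀ i < n, lastPassage x (i + 1) (j + 1) =
        lastPassage x i (j + 1) + rowUpdate j n y (i + 1, 0)) ∧
      (∀ i ≥ n, rowUpdate j n y (i + 1, 0) = y (i + 1, 0)) ∧
      lastPassage x n (j + 1) = lastPassage x n j + rowUpdate j n y (0, j + 1) ∧
      (∀ i ≥ n, rowUpdate j n y (i + 1, j + 1) = y (i + 1, j + 1)) ∧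
      (∀ j' > j, rowUpdate j n y (0, j' + 1) = y (0, j' + 1)) ∧
      ∀ i, ∀ j' > j, rowUpdate j n y (i + 1, j' + 1) = y (i + 1, j' + 1) := by
  induction n with
  | zero =>
    refine ⟨by simp, by simp [rowUpdate], ?_, by simp [rowUpdate], by simp [rowUpdate],
      by simp [rowUpdate]⟩
    simp [rowUpdate, lastPassage, h2 j le_rfl]
  | succ n ih =>
    obtain ⟨a1, a2, a3, a4, a5, a6⟩ := ih (by omega)
    have b1 := h1 n (by omega)
    have b2 := a2 n le_rfl
    have b3 := a4 n le_rfl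
    have b4 := h3 n j le_rfl
    have b5 : lastPassage x (n + 1) (j + 1) = max (lastPassage x n (j + 1))
      (lastPassage x (n + 1) j) + x (n + 1, j + 1) := by simp only [lastPassage]
    simp only [rowUpdate, siteUpdate, Prod.mk.injEq, Nat.add_right_cancel_iff, Nat.add_eq_zero_iff,
      one_ne_zero, and_false, and_true, false_and, if_false, true_and, if_true]
    refine ⟨?_, ?_, ?_, ?_, ?_, ?_⟩
    · intro i hi
      rcases Nat.lt_succ_iff_lt_or_eq.1 hi with h | rfl
      · simp [show i ≠ n by omega, a1 i h]
      · simp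
        omega
    · intro i hi
      simp [show i ≠ n by omega, a2 i (by omega)]
    · clear a1 a2 a4 a5 a6 h1 h2 h3
      omega
    · intro i hi
      simp [show i ≠ n by omega, a4 i (by omega)]
    · intro j' hj
      simp [show j' ≠ j by omega, a5 j' hj]
    · intro i j' hj
      simp [show j' ≠ j by omega, a6 i j' hj]

lemma rowsUpdate_spec (x : ℕ × ℕ → ℕ) (M j : ℕ) :
    (∀ i < M, lastPassage x (i + 1) j = lastPassage x i j + rowsUpdate M j x (i + 1, 0)) ∧
      (∀ j' ≥ j, rowsUpdate M j x (0, j' + 1) = x (0, j' + 1)) ∧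
      ∀ i, ∀ j' ≥ j, rowsUpdate M j x (i + 1, j' + 1) = x (i + 1, j' + 1) := by
  induction j with
  | zero => simp [rowsUpdate, lastPassage]
  | succ j ih =>
    obtain ⟨h1, h2, h3⟩ := ih
    obtain ⟨a1, -, -, -, a5, a6⟩ := rowUpdate_spec x (rowsUpdate M j x) M j M le_rfl h1 h2 h3
    refine ⟨a1, fun j' hj => ?_, fun i j' hj => ?_⟩
    · exact (a5 j' hj).trans (h2 j' (by omega))
    · exact (a6 i j' hj).trans (h3 i j' (by omega))

/-- The last passage time as the sum of the increments along the left side and the top side. -/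
lemma lastPassage_eq_sum_add_sum (x : ℕ × ℕ → ℕ) (M N : ℕ) :
    lastPassage x M N = ∑ k ∈ Finset.range N, x (0, k + 1)
      + ∑ k ∈ Finset.range M, rowsUpdate M N x (k + 1, 0) := by
  have h := (rowsUpdate_spec x M N).1
  rw [← lastPassage_zero_left]
  have : ∀ i ≤ M, lastPassage x i N = lastPassage x 0 N
      + ∑ k ∈ Finset.range i, rowsUpdate M N x (k + 1, 0) := by
    intro i
    induction i with
    | zero => simp
    | succ i ih =>
      intro hi
      rw [h i hi, ih (by omega), Finset.sum_range_succ, add_assoc]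
  exact this M le_rfl

/-! ### Geometric random variables -/

section LastPassagePercolation

open ProbabilityTheory

section Geometric

variable {Ω : Type*} [MeasurableSpace Ω]

/-- `X` takes the value `k` with probability `(1 - r) r ^ k`. -/
def IsGeometric (μ : Measure Ω) (X : Ω → ℕ) (r : ℝ) : Prop :=
  ∀ k : ℕ, μ {ω | X ω = k} = ENNReal.ofReal ((1 - r) * r ^ k)

/-- The variance of a geometric random variable. -/
noncomputable def geomVar (r : ℝ) : ℝ :=
  ∑' k : ℕ, (1 - r) * r ^ k * ((k : ℝ) - r / (1 - r)) ^ 2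

variable {μ : Measure Ω} {X : Ω → ℕ} {r : ℝ}

lemma IsGeometric.map_eq (h : IsGeometric μ X r) (hX : Measurable X) (hr : r ∈ Set.Ioo 0 1) :
    μ.map X = geometricMeasure ⟨1 - r, by linarith [hr.2], by linarith [hr.1]⟩ := by
  refine Measure.ext_of_singleton fun k => ?_
  rw [Measure.map_apply hX (measurableSet_singleton k), geometricMeasure_singleton]
  · simp only [sub_sub_cancel]
    rw [mul_comm]
    exact h k
  · intro h0
    have := congrArg Subtype.val h0
    simp only [Set.Icc.coe_zero] at this
    linarith [hr.2]

lemma IsGeometric.integrable_comp_iff (h : IsGeometric μ X r) (hX : Measurable X)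
    (hr : r ∈ Set.Ioo 0 1) (g : ℕ → ℝ) :
    Integrable (fun ω => g (X ω)) μ ↔ Summable (fun k : ℕ => (1 - r) * r ^ k * |g k|) := by
  have h0 : (⟨1 - r, by linarith [hr.2], by linarith [hr.1]⟩ : unitInterval) ≠ 0 := by
    intro h0
    have := congrArg Subtype.val h0
    simp only [Set.Icc.coe_zero] at this
    linarith [hr.2]
  have := integrable_geometricMeasure_iff (f := g) h0
  rw [← h.map_eq hX hr, integrable_map_measure .of_discrete hX.aemeasurable] at this
  simp only [sub_sub_cancel, Real.norm_eq_abs] at this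
  rw [show (fun ω => g (X ω)) = g ∘ X from rfl, this]
  simp only [mul_comm (1 - r)]

lemma IsGeometric.integral_comp (h : IsGeometric μ X r) (hX : Measurable X)
    (hr : r ∈ Set.Ioo 0 1) (g : ℕ → ℝ) :
    ∫ ω, g (X ω) ∂μ = ∑' k : ℕ, (1 - r) * r ^ k * g k := by
  have h0 : (⟨1 - r, by linarith [hr.2], by linarith [hr.1]⟩ : unitInterval) ≠ 0 := by
    intro h0
    have := congrArg Subtype.val h0
    simp only [Set.Icc.coe_zero] at this
    linarith [hr.2]
  have := integral_geometricMeasure h0 g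
  rw [← h.map_eq hX hr, integral_map hX.aemeasurable .of_discrete] at this
  rw [this]
  simp only [sub_sub_cancel, smul_eq_mul, mul_comm (1 - r)]

lemma IsGeometric.memLp (h : IsGeometric μ X r) (hX : Measurable X) (hr : r ∈ Set.Ioo 0 1) :
    MemLp (fun ω => (X ω : ℝ)) 2 μ := by
  have hm : Measurable (fun ω => (X ω : ℝ)) := (Measurable.of_discrete (f := Nat.cast)).comp hX
  rw [memLp_two_iff_integrable_sq hm.aestronglyMeasurable]
  rw [h.integrable_comp_iff hX hr (fun k => (k : ℝ) ^ 2)]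
  have := summable_pow_mul_geometric_of_norm_lt_one 2 (r := r)
    (by rw [Real.norm_eq_abs, abs_of_pos hr.1]; exact hr.2)
  refine (this.mul_left (1 - r)).congr fun k => ?_
  rw [abs_of_nonneg (by positivity)]
  ring

lemma IsGeometric.integral_eq (h : IsGeometric μ X r) (hX : Measurable X)
    (hr : r ∈ Set.Ioo 0 1) : ∫ ω, (X ω : ℝ) ∂μ = r / (1 - r) := by
  have h1 : (1 - r) ≠ 0 := by linarith [hr.2]
  rw [h.integral_comp hX hr (fun k => (k : ℝ))]
  have := tsum_coe_mul_geometric_of_norm_lt_one (r := r)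
    (by rw [Real.norm_eq_abs, abs_of_pos hr.1]; exact hr.2)
  calc ∑' k : ℕ, (1 - r) * r ^ k * (k : ℝ) = ∑' k : ℕ, (1 - r) * (k * r ^ k) := by
        congr 1; ext k; ring
    _ = r / (1 - r) := by rw [tsum_mul_left, this]; field_simp

lemma IsGeometric.variance_eq (h : IsGeometric μ X r) (hX : Measurable X)
    (hr : r ∈ Set.Ioo 0 1) : variance (fun ω => (X ω : ℝ)) μ = geomVar r := by
  have hm : Measurable fun ω => (X ω : ℝ) := (Measurable.of_discrete (f := Nat.cast)).comp hX
  rw [variance_eq_integral hm.aemeasurable, h.integral_eq hX hr,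
    h.integral_comp hX hr (fun k => ((k : ℝ) - r / (1 - r)) ^ 2)]
  rfl

lemma integral_abs_sub_le_sqrt_variance [IsProbabilityMeasure μ] {Y : Ω → ℝ} (hY : MemLp Y 2 μ) :
    ∫ ω, |Y ω - ∫ ω', Y ω' ∂μ| ∂μ ≤ √(variance Y μ) := by
  have h1 : MemLp (fun ω => |Y ω - ∫ ω', Y ω' ∂μ|) 2 μ := (hY.sub (memLp_const _)).abs
  refine Real.le_sqrt_of_sq_le ?_
  have h2 := variance_nonneg (fun ω => |Y ω - ∫ ω', Y ω' ∂μ|) μ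
  rw [variance_eq_sub h1] at h2
  rw [variance_eq_integral hY.aestronglyMeasurable.aemeasurable]
  simp only [Pi.pow_apply, sq_abs] at h2
  linarith

variable [IsProbabilityMeasure μ] {ι : Type*}

/-- Weak law of large numbers, in `L¹`, for sums of independent geometric random variables. -/
lemma sum_isGeometric {X : ι → Ω → ℕ} (hX : ∀ x, Measurable (X x)) (hind : iIndepFun X μ)
    (hr : r ∈ Set.Ioo 0 1) (t : Finset ι) (h : ∀ x ∈ t, IsGeometric μ (X x) r) :
    Integrable (fun ω => ∑ x ∈ t, (X x ω : ℝ)) μ ∧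
      ∫ ω, ∑ x ∈ t, (X x ω : ℝ) ∂μ = t.card * (r / (1 - r)) ∧
      ∫ ω, |∑ x ∈ t, (X x ω : ℝ) - t.card * (r / (1 - r))| ∂μ ≤ √(t.card * geomVar r) := by
  have hL : ∀ x ∈ t, MemLp (fun ω => (X x ω : ℝ)) 2 μ := fun x hx => (h x hx).memLp (hX x) hr
  have hS : MemLp (fun ω => ∑ x ∈ t, (X x ω : ℝ)) 2 μ := memLp_finsetSum t hL
  have hE : ∫ ω, ∑ x ∈ t, (X x ω : ℝ) ∂μ = t.card * (r / (1 - r)) := by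
    rw [integral_finsetSum _ fun x hx => (hL x hx).integrable (by norm_num),
      Finset.sum_congr rfl fun x hx => (h x hx).integral_eq (hX x) hr]
    simp
  refine ⟨hS.integrable (by norm_num), hE, ?_⟩
  have hV : variance (fun ω => ∑ x ∈ t, (X x ω : ℝ)) μ = t.card * geomVar r := by
    have := IndepFun.variance_sum (X := fun x ω => (X x ω : ℝ)) (s := t) (μ := μ) hL
      (fun x _ y _ hxy => (hind.indepFun hxy).comp (φ := Nat.cast) (ψ := Nat.cast)
        .of_discrete .of_discrete)
    rw [Finset.sum_congr rfl fun x hx => (h x hx).variance_eq (hX x) hr] at this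
    rw [show (fun ω => ∑ x ∈ t, (X x ω : ℝ)) = ∑ x ∈ t, fun ω => (X x ω : ℝ) by
      ext; simp, this]
    simp
  have := integral_abs_sub_le_sqrt_variance hS
  rwa [hE, hV] at this

end Geometric

/-! ### Joint laws of finitely many geometric weights -/

section Law

variable {Ω : Type*} [MeasurableSpace Ω] {Ω' : Type*} [MeasurableSpace Ω'] {ι : Type*}

/-- The coordinates `X x`, `x ∈ s`, are independent and geometric with parameters `p x`. -/
def HasGeometricLaw (s : Finset ι) (p : ι → ℝ) (μ : Measure Ω) (X : Ω → ι → ℕ) : Prop :=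
  ∀ f : ι → ℕ, μ {ω | ∀ x ∈ s, X ω x = f x} = ENNReal.ofReal (∏ x ∈ s, (1 - p x) * p x ^ f x)

variable {μ : Measure Ω} {ν : Measure Ω'} {p : ι → ℝ} {s : Finset ι}

lemma hasGeometricLaw_of_iIndepFun {X : ι → Ω → ℕ} (hind : iIndepFun X μ)
    (hp : ∀ x ∈ s, p x ∈ Set.Ioo (0 : ℝ) 1) (h : ∀ x ∈ s, IsGeometric μ (X x) (p x)) :
    HasGeometricLaw s p μ (fun ω x => X x ω) := by
  intro f
  have h1 := hind.measure_inter_preimage_eq_mul s (sets := fun x => {f x})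
    (fun x _ => measurableSet_singleton _)
  have h2 : {ω | ∀ x ∈ s, X x ω = f x} = ⋂ x ∈ s, X x ⁻¹' {f x} := by
    ext ω; simp
  rw [h2, h1, ENNReal.ofReal_prod_of_nonneg]
  · exact Finset.prod_congr rfl fun x hx => h x hx (f x)
  · intro x hx
    have := hp x hx
    exact mul_nonneg (by linarith [this.2]) (pow_nonneg this.1.le _)

lemma HasGeometricLaw.identDistrib {X : Ω → ι → ℕ} {Y : Ω' → ι → ℕ}
    (hX : HasGeometricLaw s p μ X) (hY : HasGeometricLaw s p ν Y) (mX : Measurable X)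
    (mY : Measurable Y) :
    IdentDistrib (fun ω => s.restrict (X ω)) (fun ω => s.restrict (Y ω)) μ ν := by
  classical
  have m1 : Measurable (fun ω => s.restrict (X ω)) := (Finset.measurable_restrict s).comp mX
  have m2 : Measurable (fun ω => s.restrict (Y ω)) := (Finset.measurable_restrict s).comp mY
  refine ⟨m1.aemeasurable, m2.aemeasurable, Measure.ext_of_singleton fun f => ?_⟩
  rw [Measure.map_apply m1 (measurableSet_singleton f),
    Measure.map_apply m2 (measurableSet_singleton f)]
  let g : ι → ℕ := fun x => if h : x ∈ s then f ⟨x, h⟩ else 0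
  have key : ∀ z : ι → ℕ, s.restrict z = f ↔ ∀ x ∈ s, z x = g x := by
    intro z
    constructor
    · rintro rfl x hx
      simp [g, hx]
    · intro h
      ext ⟨x, hx⟩
      simp [h x hx, g, hx]
  have e1 : (fun ω => s.restrict (X ω)) ⁻¹' {f} = {ω | ∀ x ∈ s, X ω x = g x} := by
    ext ω; exact key _
  have e2 : (fun ω => s.restrict (Y ω)) ⁻¹' {f} = {ω | ∀ x ∈ s, Y ω x = g x} := by
    ext ω; exact key _
  rw [e1, e2, hX g, hY g]

/-- Two families with the same geometric law on `s` give the same law to every function of the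
coordinates in `s`. -/
lemma HasGeometricLaw.identDistrib_comp {X : Ω → ι → ℕ} {Y : Ω' → ι → ℕ}
    (hX : HasGeometricLaw s p μ X) (hY : HasGeometricLaw s p ν Y) (mX : Measurable X)
    (mY : Measurable Y) (F : (ι → ℕ) → ℝ) (hF : ∀ x y, (∀ a ∈ s, x a = y a) → F x = F y) :
    IdentDistrib (fun ω => F (X ω)) (fun ω => F (Y ω)) μ ν := by
  classical
  let E : (s → ℕ) → ι → ℕ := fun f x => if h : x ∈ s then f ⟨x, h⟩ else 0
  have h1 := (hX.identDistrib hY mX mY).comp (u := fun f => F (E f)) .of_discrete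
  have key : ∀ z : ι → ℕ, F (E (s.restrict z)) = F z := fun z =>
    hF _ _ fun a ha => by simp [E, ha]
  simpa only [Function.comp_def, key] using h1

end Law

section Burke

variable {Ω : Type*} [MeasurableSpace Ω] {μ : Measure Ω}

lemma measurable_siteUpdate (i j : ℕ) : Measurable (siteUpdate i j) := by
  refine measurable_pi_iff.2 fun p => ?_
  have hsub : ∀ a b : ℕ × ℕ, Measurable fun x : ℕ × ℕ → ℕ => x a - x b := fun a b =>
    Measurable.of_discrete.comp (g := fun z : ℕ × ℕ => z.1 - z.2)
      (f := fun x : ℕ × ℕ → ℕ => (x a, x b))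
      ((measurable_pi_apply a).prodMk (measurable_pi_apply b))
  have hmin : ∀ a b : ℕ × ℕ, Measurable fun x : ℕ × ℕ → ℕ => min (x a) (x b) := fun a b =>
    (measurable_pi_apply a).min (measurable_pi_apply b)
  unfold siteUpdate
  split_ifs
  · exact (measurable_pi_apply _).add (hsub _ _)
  · exact (measurable_pi_apply _).add (hsub _ _)
  · exact hmin _ _
  · exact measurable_pi_apply _

lemma measurable_rowUpdate (j n : ℕ) : Measurable (rowUpdate j n) := by
  induction n with
  | zero => exact measurable_id
  | succ n ih => exact (measurable_siteUpdate _ _).comp ih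

lemma measurable_rowsUpdate (M j : ℕ) : Measurable (rowsUpdate M j) := by
  induction j with
  | zero => exact measurable_id
  | succ j ih => exact (measurable_rowUpdate _ _).comp ih

/-- The local Burke property: if the parameters of the two boundary weights multiply to that of
the bulk weight, the local update preserves the joint law. -/
lemma HasGeometricLaw.siteUpdate {s : Finset (ℕ × ℕ)} {p : ℕ × ℕ → ℝ} {X : Ω → ℕ × ℕ → ℕ}
    (hX : HasGeometricLaw s p μ X) {i j : ℕ} (ha : (i + 1, 0) ∈ s) (hb : (0, j + 1) ∈ s)
    (hc : (i + 1, j + 1) ∈ s) (hp : p (i + 1, 0) * p (0, j + 1) = p (i + 1, j + 1)) :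
    HasGeometricLaw s p μ (fun ω => siteUpdate (i + 1) (j + 1) (X ω)) := by
  intro f
  have loc : ∀ y z : ℕ × ℕ → ℕ, (∀ x ∈ s, y x = z x) →
      ∀ x ∈ s, _root_.siteUpdate (i + 1) (j + 1) y x = _root_.siteUpdate (i + 1) (j + 1) z x := by
    intro y z h x hx
    simp only [_root_.siteUpdate, h _ ha, h _ hb, h _ hc, h _ hx]
  have hset : {ω | ∀ x ∈ s, _root_.siteUpdate (i + 1) (j + 1) (X ω) x = f x} =
      {ω | ∀ x ∈ s, X ω x = _root_.siteUpdate (i + 1) (j + 1) f x} := by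
    ext ω
    constructor
    · intro h x hx
      have := loc _ _ h x hx
      rwa [siteUpdate_involutive] at this
    · intro h x hx
      have := loc _ _ h x hx
      rwa [siteUpdate_involutive] at this
  rw [hset, hX]
  congr 1
  rw [Finset.prod_mul_distrib, Finset.prod_mul_distrib]
  congr 1
  have hb' : (0, j + 1) ∈ s.erase (i + 1, 0) := by simp [hb]
  have hc' : (i + 1, j + 1) ∈ (s.erase (i + 1, 0)).erase (0, j + 1) := by simp [hc]
  rw [← Finset.mul_prod_erase _ _ ha, ← Finset.mul_prod_erase _ _ hb',
    ← Finset.mul_prod_erase _ _ hc', ← Finset.mul_prod_erase _ _ ha,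
    ← Finset.mul_prod_erase _ _ hb', ← Finset.mul_prod_erase _ _ hc', ← mul_assoc, ← mul_assoc,
    ← mul_assoc, ← mul_assoc]
  congr 1
  · simp only [_root_.siteUpdate, Prod.mk.injEq, Nat.add_eq_zero_iff, one_ne_zero, and_false,
      and_true, false_and, if_true, if_false, true_and, ← hp, mul_pow]
    generalize f (i + 1, 0) = u
    generalize f (0, j + 1) = v
    generalize f (i + 1, j + 1) = w
    rcases le_total u v with h | h
    · obtain ⟨d, rfl⟩ := Nat.exists_eq_add_of_le h
      simp [pow_add]
      ring
    · obtain ⟨d, rfl⟩ := Nat.exists_eq_add_of_le h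
      simp [pow_add]
      ring
  · refine Finset.prod_congr rfl fun x hx => ?_
    simp only [Finset.mem_erase] at hx
    simp only [_root_.siteUpdate, hx.1, hx.2.1, hx.2.2.1, if_false]

/-- The parameters of the stationary model: `r` on the horizontal axis, `q / r` on the vertical
axis, `q` elsewhere. -/
noncomputable def stationaryParam (q r : ℝ) (p : ℕ × ℕ) : ℝ :=
  if p.1 = 0 then (if p.2 = 0 then q else q / r) else if p.2 = 0 then r else q

lemma stationaryParam_mem {q r : ℝ} (hq : 0 < q) (hqr : q < r) (hr : r < 1) (p : ℕ × ℕ) :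
    stationaryParam q r p ∈ Set.Ioo (0 : ℝ) 1 := by
  have hr0 : 0 < r := hq.trans hqr
  unfold stationaryParam
  split_ifs
  · exact ⟨hq, hqr.trans hr⟩
  · exact ⟨by positivity, (div_lt_one hr0).2 hqr⟩
  · exact ⟨hr0, hr⟩
  · exact ⟨hq, hqr.trans hr⟩

/-- The sites of the rectangle with corners `(0,0)` and `(M,N)`. -/
def box (M N : ℕ) : Finset (ℕ × ℕ) := Finset.range (M + 1) ×ˢ Finset.range (N + 1)

lemma mem_box {M N i j : ℕ} : (i, j) ∈ box M N ↔ i ≤ M ∧ j ≤ N := by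
  simp [box]

/-- Burke's theorem: the horizontal increments on the top side of a rectangle have the law of those
on the bottom side. -/
lemma HasGeometricLaw.rowsUpdate {q r : ℝ} (hr : r ≠ 0) {M N : ℕ} {X : Ω → ℕ × ℕ → ℕ}
    (hX : HasGeometricLaw (box M N) (stationaryParam q r) μ X) (j : ℕ) (hj : j ≤ N) :
    HasGeometricLaw (box M N) (stationaryParam q r) μ (fun ω => rowsUpdate M j (X ω)) := by
  induction j with
  | zero => exact hX
  | succ j ih =>
    have hrow : ∀ n ≤ M, HasGeometricLaw (box M N) (stationaryParam q r) μ
        (fun ω => rowUpdate j n (_root_.rowsUpdate M j (X ω))) := by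
      intro n
      induction n with
      | zero => intro _; exact ih (by omega)
      | succ n ihn =>
        intro hn
        refine (ihn (by omega)).siteUpdate (mem_box.2 ⟨hn, by omega⟩) (mem_box.2 ⟨by omega, hj⟩)
          (mem_box.2 ⟨hn, hj⟩) ?_
        simp [stationaryParam]
        field_simp
    exact hrow M le_rfl

variable [IsProbabilityMeasure μ]

lemma measurable_lastPassage (i j : ℕ) :
    Measurable (fun x : ℕ × ℕ → ℕ => (lastPassage x i j : ℝ)) := by
  have : Measurable (fun x : ℕ × ℕ → ℕ => lastPassage x i j) := by
    have h : (fun x : ℕ × ℕ → ℕ => lastPassage x i j) = fun x =>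
      ∑ k ∈ Finset.range j, x (0, k + 1) + ∑ k ∈ Finset.range i, rowsUpdate i j x (k + 1, 0) := by
      ext x; exact lastPassage_eq_sum_add_sum x i j
    rw [h]
    refine (Finset.measurable_sum _ fun k _ => measurable_pi_apply (0, k + 1)).add
      (Finset.measurable_sum _ fun k _ => ?_)
    exact (measurable_pi_apply (k + 1, 0)).comp (measurable_rowsUpdate i j)
  exact (Measurable.of_discrete (f := (Nat.cast : ℕ → ℝ))).comp this

/-- The weights on the first `K` sites of the horizontal axis in the stationary model. -/
lemma sum_horizontal {X : ℕ × ℕ → Ω → ℕ} {q r : ℝ} (hX : ∀ x, Measurable (X x))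
    (hind : iIndepFun X μ) (hr : r ∈ Set.Ioo 0 1)
    (h : ∀ x, IsGeometric μ (X x) (stationaryParam q r x)) (K : ℕ) :
    Integrable (fun ω => ∑ k ∈ Finset.range K, (X (k + 1, 0) ω : ℝ)) μ ∧
      ∫ ω, ∑ k ∈ Finset.range K, (X (k + 1, 0) ω : ℝ) ∂μ = K * (r / (1 - r)) ∧
      ∫ ω, |∑ k ∈ Finset.range K, (X (k + 1, 0) ω : ℝ) - K * (r / (1 - r))| ∂μ ≤
        √(K * geomVar r) := by
  have := sum_isGeometric (X := fun k : ℕ => X (k + 1, 0)) (μ := μ) (fun k => hX _)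
    (hind.precomp (g := fun k : ℕ => (k + 1, 0)) (fun a b hab => by simpa using hab)) hr
    (Finset.range K) (fun k _ => by simpa [stationaryParam] using h (k + 1, 0))
  simpa using this

/-- The weights on the first `K` sites of the vertical axis in the stationary model. -/
lemma sum_vertical {X : ℕ × ℕ → Ω → ℕ} {q r : ℝ} (hX : ∀ x, Measurable (X x))
    (hind : iIndepFun X μ) (hq : 0 < q) (hqr : q < r)
    (h : ∀ x, IsGeometric μ (X x) (stationaryParam q r x)) (K : ℕ) :
    Integrable (fun ω => ∑ k ∈ Finset.range K, (X (0, k + 1) ω : ℝ)) μ ∧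
      ∫ ω, ∑ k ∈ Finset.range K, (X (0, k + 1) ω : ℝ) ∂μ = K * (q / (r - q)) ∧
      ∫ ω, |∑ k ∈ Finset.range K, (X (0, k + 1) ω : ℝ) - K * (q / (r - q))| ∂μ ≤
        √(K * geomVar (q / r)) := by
  have hr0 : 0 < r := hq.trans hqr
  have := sum_isGeometric (X := fun k : ℕ => X (0, k + 1)) (μ := μ) (r := q / r) (fun k => hX _)
    (hind.precomp (g := fun k : ℕ => (0, k + 1)) (fun a b hab => by simpa using hab))
    ⟨by positivity, (div_lt_one hr0).2 hqr⟩
    (Finset.range K) (fun k _ => by simpa [stationaryParam] using h (0, k + 1))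
  have e : q / r / (1 - q / r) = q / (r - q) := by
    have : r - q ≠ 0 := by linarith
    field_simp
  rw [e] at this
  simpa using this

/-- The last passage time of the stationary model has an explicit mean, and it is concentrated
around its mean. -/
lemma lastPassage_stationary {X : ℕ × ℕ → Ω → ℕ} {q r : ℝ} (hX : ∀ x, Measurable (X x))
    (hind : iIndepFun X μ) (hq : 0 < q) (hqr : q < r) (hr : r < 1)
    (h : ∀ x, IsGeometric μ (X x) (stationaryParam q r x)) (M N : ℕ) :
    Integrable (fun ω => (lastPassage (fun x => X x ω) M N : ℝ)) μ ∧
      ∫ ω, (lastPassage (fun x => X x ω) M N : ℝ) ∂μ = M * (r / (1 - r)) + N * (q / (r - q)) ∧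
      ∫ ω, |(lastPassage (fun x => X x ω) M N : ℝ)
          - (M * (r / (1 - r)) + N * (q / (r - q)))| ∂μ ≤
        √(M * geomVar r) + √(N * geomVar (q / r)) := by
  have hr0 : 0 < r := hq.trans hqr
  obtain ⟨v1, v2, v3⟩ := sum_vertical hX hind hq hqr h N
  obtain ⟨u1, u2, u3⟩ := sum_horizontal hX hind ⟨hr0, hr⟩ h M
  have law : HasGeometricLaw (box M N) (stationaryParam q r) μ (fun ω x => X x ω) :=
    hasGeometricLaw_of_iIndepFun hind (fun x _ => stationaryParam_mem hq hqr hr x) fun x _ => h x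
  have law' := law.rowsUpdate hr0.ne' N le_rfl
  have mX : Measurable fun ω x => X x ω := measurable_pi_iff.2 hX
  have ident := law'.identDistrib_comp law ((measurable_rowsUpdate M N).comp mX) mX
    (fun x => ∑ k ∈ Finset.range M, (x (k + 1, 0) : ℝ)) (fun x y hxy =>
      Finset.sum_congr rfl fun k hk => by
        rw [hxy _ (mem_box.2 ⟨Finset.mem_range.1 hk, Nat.zero_le _⟩)])
  have ident' := ident.comp (u := fun y => |y - M * (r / (1 - r))|) (by fun_prop)
  have t1 := ident.integrable_iff.2 u1
  have t2 := ident.integral_eq.trans u2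
  have t3 := ident'.integral_eq.trans_le u3
  simp only [Function.comp_def] at t3
  set U : Ω → ℝ := fun ω => ∑ k ∈ Finset.range M,
    (_root_.rowsUpdate M N (fun x => X x ω) (k + 1, 0) : ℝ)
  set V : Ω → ℝ := fun ω => ∑ k ∈ Finset.range N, (X (0, k + 1) ω : ℝ)
  have e : ∀ ω, (lastPassage (fun x => X x ω) M N : ℝ) = V ω + U ω := by
    intro ω
    rw [lastPassage_eq_sum_add_sum]
    push_cast
    rfl
  simp only [e]
  refine ⟨v1.add t1, ?_, ?_⟩
  · rw [integral_add v1 t1, t2, v2, add_comm]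
  · have a1 : Integrable (fun ω => |V ω - N * (q / (r - q))|) μ :=
      (v1.sub (integrable_const _)).abs
    have a2 : Integrable (fun ω => |U ω - M * (r / (1 - r))|) μ :=
      (t1.sub (integrable_const _)).abs
    calc ∫ ω, |V ω + U ω - (M * (r / (1 - r)) + N * (q / (r - q)))| ∂μ
        ≤ ∫ ω, (|U ω - M * (r / (1 - r))| + |V ω - N * (q / (r - q))|) ∂μ := by
          refine integral_mono ((v1.add t1).sub (integrable_const _)).abs (a2.add a1) fun ω => ?_
          have := abs_add_le (U ω - M * (r / (1 - r))) (V ω - N * (q / (r - q)))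
          refine le_trans (le_of_eq ?_) this
          dsimp only [Pi.add_apply]
          congr 1
          ring
      _ ≤ _ := by
          rw [integral_add a2 a1]
          exact add_le_add t3 v3

end Burke

/-! ### A monotone coupling of geometric weights -/

section Coupling

/-- The value at `u` of the quantile transform of the geometric law with parameter `p`. -/
noncomputable def geomQuantile (p u : ℝ) : ℕ := sInf {k : ℕ | p ^ (k + 1) < u}

/-- The uniform measure on `(0,1]`. -/
noncomputable def unifMeasure : Measure ℝ := volume.restrict (Set.Ioc 0 1)

instance : IsProbabilityMeasure unifMeasure := ⟨by simp [unifMeasure]⟩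

lemma geomQuantile_mono {p p' : ℝ} (hp : 0 ≤ p) (h : p ≤ p') (hp' : p' < 1) (u : ℝ) :
    geomQuantile p u ≤ geomQuantile p' u := by
  unfold geomQuantile
  rcases le_or_gt u 0 with hu | hu
  · have : {k : ℕ | p ^ (k + 1) < u} = ∅ := by
      ext k
      have : 0 ≤ p ^ (k + 1) := by positivity
      simp only [Set.mem_ofPred_eq, Set.mem_empty_iff_false, iff_false, not_lt]
      linarith
    simp [this]
  · obtain ⟨n, hn⟩ := exists_pow_lt_of_lt_one hu hp'
    have hne : {k : ℕ | p' ^ (k + 1) < u}.Nonempty :=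
      ⟨n, lt_of_le_of_lt (pow_le_pow_of_le_one (hp.trans h) hp'.le (Nat.le_succ n)) hn⟩
    exact Nat.sInf_le (lt_of_le_of_lt (pow_le_pow_left₀ hp h _) (Nat.sInf_mem hne))

lemma geomQuantile_eq_iff {p : ℝ} (hp : p ∈ Set.Ioo 0 1) {u : ℝ} (hu : 0 < u) (hu1 : u ≤ 1)
    (k : ℕ) : geomQuantile p u = k ↔ p ^ (k + 1) < u ∧ u ≤ p ^ k := by
  obtain ⟨n, hn⟩ := exists_pow_lt_of_lt_one hu hp.2
  have hne : {k : ℕ | p ^ (k + 1) < u}.Nonempty :=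
    ⟨n, lt_of_le_of_lt (pow_le_pow_of_le_one hp.1.le hp.2.le (Nat.le_succ n)) hn⟩
  unfold geomQuantile
  constructor
  · rintro rfl
    refine ⟨Nat.sInf_mem hne, ?_⟩
    rcases Nat.eq_zero_or_pos (sInf {k : ℕ | p ^ (k + 1) < u}) with h0 | h0
    · rw [h0]; simpa using hu1
    · have := Nat.notMem_of_lt_sInf (show sInf {k : ℕ | p ^ (k + 1) < u} - 1 <
        sInf {k : ℕ | p ^ (k + 1) < u} by omega)
      rw [Set.mem_ofPred_eq, not_lt, Nat.sub_add_cancel h0] at this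
      exact this
  · rintro ⟨h1, h2⟩
    refine le_antisymm (Nat.sInf_le h1) (le_csInf hne fun j hj => ?_)
    by_contra hlt
    have : p ^ k ≤ p ^ (j + 1) := pow_le_pow_of_le_one hp.1.le hp.2.le (by omega)
    exact absurd (lt_of_le_of_lt this hj) (not_lt.2 h2)

lemma measurable_geomQuantile {p : ℝ} (hp : p ∈ Set.Ioo 0 1) : Measurable (geomQuantile p) := by
  refine measurable_to_countable' fun k => ?_
  have h : geomQuantile p ⁻¹' {k} = (Set.Ioc 0 1 ∩ Set.Ioc (p ^ (k + 1)) (p ^ k)) ∪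
      {u | u ∉ Set.Ioc (0 : ℝ) 1 ∧ k = 0} := by
    ext u
    by_cases hu : u ∈ Set.Ioc (0 : ℝ) 1
    · have := geomQuantile_eq_iff hp hu.1 hu.2 k
      simp only [Set.mem_preimage, Set.mem_singleton_iff, Set.mem_union, Set.mem_inter_iff,
        Set.mem_ofPred_eq, this, Set.mem_Ioc (a := p ^ (k + 1))]
      tauto
    · have : geomQuantile p u = 0 := by
        unfold geomQuantile
        rw [Nat.sInf_eq_zero]
        rcases le_or_gt u 0 with h0 | h0
        · right
          ext j
          have := pow_pos hp.1 (j + 1)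
          simp only [Set.mem_ofPred_eq, Set.mem_empty_iff_false, iff_false, not_lt]
          linarith
        · left
          have h1 : 1 < u := by
            by_contra h1
            exact hu ⟨h0, not_lt.1 h1⟩
          simpa using hp.2.trans h1
      simp only [Set.mem_preimage, Set.mem_singleton_iff, Set.mem_union, Set.mem_inter_iff,
        Set.mem_ofPred_eq, this, eq_comm (a := 0)]
      tauto
  rw [h]
  refine (measurableSet_Ioc.inter measurableSet_Ioc).union ?_
  exact measurableSet_Ioc.compl.inter (.const _)

lemma isGeometric_geomQuantile {p : ℝ} (hp : p ∈ Set.Ioo 0 1) :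
    IsGeometric unifMeasure (geomQuantile p) p := by
  intro k
  rw [unifMeasure, Measure.restrict_apply' measurableSet_Ioc]
  have : {u | geomQuantile p u = k} ∩ Set.Ioc 0 1 = Set.Ioc (p ^ (k + 1)) (p ^ k) := by
    ext u
    constructor
    · rintro ⟨h1, h2⟩
      exact (geomQuantile_eq_iff hp h2.1 h2.2 k).1 h1
    · rintro ⟨h1, h2⟩
      have h0 : 0 < u := (pow_pos hp.1 _).trans h1
      have h3 : u ≤ 1 := h2.trans (pow_le_one₀ hp.1.le hp.2.le)
      exact ⟨(geomQuantile_eq_iff hp h0 h3 k).2 ⟨h1, h2⟩, h0, h3⟩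
  rw [this, Real.volume_Ioc]
  congr 1
  ring

/-- The probability space carrying the coupling: independent uniform variables at all sites. -/
noncomputable def siteMeasure : Measure (ℕ × ℕ → ℝ) := Measure.infinitePi fun _ => unifMeasure

instance : IsProbabilityMeasure siteMeasure := by unfold siteMeasure; infer_instance

/-- The weights of the stationary model with parameter `r`, coupled monotonically in `r`. -/
noncomputable def stationaryWeight (q r : ℝ) (x : ℕ × ℕ) (ω : ℕ × ℕ → ℝ) : ℕ :=
  geomQuantile (stationaryParam q r x) (ω x)

variable {q r : ℝ}

lemma measurable_stationaryWeight (hq : 0 < q) (hqr : q < r) (hr : r < 1) (x : ℕ × ℕ) :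
    Measurable (stationaryWeight q r x) :=
  (measurable_geomQuantile (stationaryParam_mem hq hqr hr x)).comp (measurable_pi_apply x)

lemma iIndepFun_stationaryWeight (hq : 0 < q) (hqr : q < r) (hr : r < 1) :
    iIndepFun (stationaryWeight q r) siteMeasure :=
  iIndepFun_infinitePi (X := fun x u => geomQuantile (stationaryParam q r x) u)
    fun x => measurable_geomQuantile (stationaryParam_mem hq hqr hr x)

lemma isGeometric_stationaryWeight (hq : 0 < q) (hqr : q < r) (hr : r < 1) (x : ℕ × ℕ) :
    IsGeometric siteMeasure (stationaryWeight q r x) (stationaryParam q r x) := by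
  intro k
  have hm := measurable_geomQuantile (stationaryParam_mem hq hqr hr x)
  rw [← isGeometric_geomQuantile (stationaryParam_mem hq hqr hr x) k,
    ← Measure.infinitePi_map_eval (fun _ : ℕ × ℕ => unifMeasure) x,
    Measure.map_apply (measurable_pi_apply x) (hm (measurableSet_singleton k))]
  rfl

end Coupling

/-! ### Bounds on the mean passage time -/

section Bounds

/-- The mean last passage time from `(1,1)` to `(M,N)` in the coupling. -/
lemma integral_lppSup_eq {Ω : Type*} [MeasurableSpace Ω] {μ : Measure Ω} {q r : ℝ}
    (hq : 0 < q) (hqr : q < r) (hr : r < 1) {w : ℕ × ℕ → Ω → ℕ}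
    (hmeas : ∀ p, Measurable (w p)) (hindep : iIndepFun w μ)
    (hgeom : ∀ p, IsGeometric μ (w p) q) {M N : ℕ} (hM : 1 ≤ M) (hN : 1 ≤ N) :
    ∫ ω, (lppSup (fun p => w p ω) M N : ℝ) ∂μ =
      ∫ ω, (lastPassage (interiorWeight fun x => stationaryWeight q r x ω) M N : ℝ)
        ∂siteMeasure := by
  have hq1 : q < 1 := hqr.trans hr
  have l1 : HasGeometricLaw (Finset.Icc 1 M ×ˢ Finset.Icc 1 N) (fun _ => q) μ (fun ω x => w x ω) :=
    hasGeometricLaw_of_iIndepFun hindep (fun x _ => ⟨hq, hq1⟩) fun x _ => hgeom x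
  have l2 : HasGeometricLaw (Finset.Icc 1 M ×ˢ Finset.Icc 1 N) (fun _ => q) siteMeasure
      (fun ω x => stationaryWeight q r x ω) := by
    refine hasGeometricLaw_of_iIndepFun (iIndepFun_stationaryWeight hq hqr hr)
      (fun x _ => ⟨hq, hq1⟩) fun x hx => ?_
    have := isGeometric_stationaryWeight hq hqr hr x
    simp only [Finset.mem_product, Finset.mem_Icc] at hx
    rwa [stationaryParam, if_neg (by omega), if_neg (by omega)] at this
  have := (l1.identDistrib_comp l2 (measurable_pi_iff.2 hmeas)
    (measurable_pi_iff.2 (measurable_stationaryWeight hq hqr hr))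
    (fun x => (lastPassage (interiorWeight x) M N : ℝ)) (fun x y hxy => by
      rw [lastPassage_congr M N (fun i hi j hj => ?_) M le_rfl N le_rfl]
      unfold interiorWeight
      split_ifs with h
      · rfl
      · exact hxy _ (by simp only [Finset.mem_product, Finset.mem_Icc]; omega))).integral_eq
  rw [← this]
  simp only [lppSup_eq_lastPassage _ hM hN]

variable {q r : ℝ}

lemma integrable_lastPassage_interiorWeight (hq : 0 < q) (hqr : q < r) (hr : r < 1) (M N : ℕ) :
    Integrable (fun ω => (lastPassage (interiorWeight fun x => stationaryWeight q r x ω) M N : ℝ))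
      siteMeasure := by
  have h := lastPassage_stationary (measurable_stationaryWeight hq hqr hr)
    (iIndepFun_stationaryWeight hq hqr hr) hq hqr hr (isGeometric_stationaryWeight hq hqr hr) M N
  refine h.1.mono' ?_ (.of_forall fun ω => ?_)
  · refine ((measurable_lastPassage M N).comp
      (measurable_pi_iff.2 fun x => ?_)).aestronglyMeasurable
    unfold interiorWeight
    split_ifs
    · exact measurable_const
    · exact measurable_stationaryWeight hq hqr hr x
  · rw [Real.norm_of_nonneg (by positivity)]
    exact_mod_cast lastPassage_mono (interiorWeight_le _) M N

lemma integral_lastPassage_interiorWeight_le (hq : 0 < q) (hqr : q < r) (hr : r < 1) (M N : ℕ) :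
    ∫ ω, (lastPassage (interiorWeight fun x => stationaryWeight q r x ω) M N : ℝ) ∂siteMeasure ≤
      M * (r / (1 - r)) + N * (q / (r - q)) := by
  have h := lastPassage_stationary (measurable_stationaryWeight hq hqr hr)
    (iIndepFun_stationaryWeight hq hqr hr) hq hqr hr (isGeometric_stationaryWeight hq hqr hr) M N
  rw [← h.2.1]
  refine integral_mono (integrable_lastPassage_interiorWeight hq hqr hr M N) h.1 fun ω => ?_
  exact Nat.cast_le.2 (lastPassage_mono (interiorWeight_le _) M N)

lemma le_add_mul_of_le_max {x y z g u v c d m m₁ m₂ K a b a₁ b₂ Δ : ℝ} (hΔ : 0 < Δ)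
    (hm : 0 ≤ m) (hu : 0 ≤ u) (hv : 0 ≤ v) (hg : 0 ≤ g)
    (h : x ≤ max (g + (u + v)) (max (y - (c - u)) (z - (d - v))))
    (h₁ : m₁ - K * (a₁ - a) ≤ m - Δ) (h₂ : m₂ - K * (b₂ - b) ≤ m - Δ) :
    x ≤ g + (u + v) + (1 + m / Δ) * (|x - m| + |y - m₁| + |z - m₂| + |u - K * a| + |v - K * b|
      + |c - K * a₁| + |d - K * b₂|) := by
  have e1 := neg_abs_le (x - m)
  have e1' := le_abs_self (x - m)
  have e2 := le_abs_self (y - m₁)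
  have e3 := le_abs_self (z - m₂)
  have e4 := le_abs_self (u - K * a)
  have e5 := le_abs_self (v - K * b)
  have e6 := neg_abs_le (c - K * a₁)
  have e7 := neg_abs_le (d - K * b₂)
  have p1 := abs_nonneg (x - m)
  have p2 := abs_nonneg (y - m₁)
  have p3 := abs_nonneg (z - m₂)
  have p4 := abs_nonneg (u - K * a)
  have p5 := abs_nonneg (v - K * b)
  have p6 := abs_nonneg (c - K * a₁)
  have p7 := abs_nonneg (d - K * b₂)
  rw [mul_sub] at h₁ h₂
  set E := |x - m| + |y - m₁| + |z - m₂| + |u - K * a| + |v - K * b| + |c - K * a₁|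
    + |d - K * b₂| with hE
  have hE0 : 0 ≤ E := by linarith
  have hmE : 0 ≤ m / Δ * E := mul_nonneg (div_nonneg hm hΔ.le) hE0
  rw [add_mul, one_mul]
  by_cases hx : x ≤ g + (u + v)
  · linarith
  · have hlarge : Δ ≤ E := by
      rcases le_max_iff.1 h with h' | h'
      · exact absurd h' hx
      · rcases le_max_iff.1 h' with h' | h' <;> linarith
    have : m ≤ m / Δ * E := by
      rw [div_mul_eq_mul_div, le_div_iff₀ hΔ]
      exact mul_le_mul_of_nonneg_left hlarge hm
    linarith

lemma add_le_of_sqrt_bounds {x y z u v c d t x₁ x₂ y₁ y₂ z₁ z₂ u₁ v₁ c₁ d₁ a b a₁ b₁ a₂ b₂ : ℝ}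
    (hx : x ≤ x₁ + x₂) (hy : y ≤ y₁ + y₂) (hz : z ≤ z₁ + z₂) (hu : u ≤ u₁) (hv : v ≤ v₁)
    (hc : c ≤ c₁) (hd : d ≤ d₁) (hx₁ : x₁ ≤ t * a) (hx₂ : x₂ ≤ t * b) (hy₁ : y₁ ≤ t * a₁)
    (hy₂ : y₂ ≤ t * b₁) (hz₁ : z₁ ≤ t * a₂) (hz₂ : z₂ ≤ t * b₂) (hu₁ : u₁ ≤ t * a)
    (hv₁ : v₁ ≤ t * b) (hc₁ : c₁ ≤ t * a₁) (hd₁ : d₁ ≤ t * b₂) (h₁ : 0 ≤ t * b₁)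
    (h₂ : 0 ≤ t * a₂) :
    x + y + z + u + v + c + d ≤ t * (2 * (a + b + a₁ + b₁ + a₂ + b₂)) := by
  linarith

/-- If moving the parameter of the stationary model away from `r` in either direction changes its
mean by less, up to a gap `Δ`, than it changes the mean of `K` boundary weights, then the mean
passage time from `(1,1)` is close to the one of the stationary model. -/
lemma le_integral_lastPassage_interiorWeight (hq : 0 < q) (hqr : q < r) (hr : r < 1)
    {r₁ r₂ : ℝ} (hr₁ : r < r₁) (hr₁' : r₁ < 1) (hr₂ : q < r₂) (hr₂' : r₂ < r)
    {M N K : ℕ} {Δ : ℝ} (hΔ : 0 < Δ) (hNM : N ≤ M) (hKM : K ≤ M)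
    (h₁ : M * (r₁ / (1 - r₁)) + N * (q / (r₁ - q)) - K * (r₁ / (1 - r₁) - r / (1 - r)) ≤
      M * (r / (1 - r)) + N * (q / (r - q)) - Δ)
    (h₂ : M * (r₂ / (1 - r₂)) + N * (q / (r₂ - q)) - K * (q / (r₂ - q) - q / (r - q)) ≤
      M * (r / (1 - r)) + N * (q / (r - q)) - Δ) :
    M * (r / (1 - r)) + N * (q / (r - q)) ≤
      ∫ ω, (lastPassage (interiorWeight fun x => stationaryWeight q r x ω) M N : ℝ) ∂siteMeasure
        + K * (r / (1 - r) + q / (r - q))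
        + (1 + (M * (r / (1 - r)) + N * (q / (r - q))) / Δ) * (√M * (2 * (√(geomVar r)
          + √(geomVar (q / r)) + √(geomVar r₁) + √(geomVar (q / r₁)) + √(geomVar r₂)
          + √(geomVar (q / r₂))))) := by
  have hr0 : 0 < r := hq.trans hqr
  have hqr₁ : q < r₁ := hqr.trans hr₁
  have hr₂1 : r₂ < 1 := hr₂'.trans hr
  have hr₁0 : 0 < r₁ := hq.trans hqr₁
  have hr₂0 : 0 < r₂ := hq.trans hr₂
  have IX := integrable_lastPassage_interiorWeight hq hqr hr M N
  have mX := measurable_stationaryWeight hq hqr hr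
  have mY := measurable_stationaryWeight hq hqr₁ hr₁'
  have mZ := measurable_stationaryWeight hq hr₂ hr₂1
  have iX := iIndepFun_stationaryWeight hq hqr hr
  have iY := iIndepFun_stationaryWeight hq hqr₁ hr₁'
  have iZ := iIndepFun_stationaryWeight hq hr₂ hr₂1
  have gX := isGeometric_stationaryWeight hq hqr hr
  have gY := isGeometric_stationaryWeight hq hqr₁ hr₁'
  have gZ := isGeometric_stationaryWeight hq hr₂ hr₂1
  obtain ⟨SX1, SX2, SX3⟩ := lastPassage_stationary mX iX hq hqr hr gX M N
  obtain ⟨SY1, -, SY3⟩ := lastPassage_stationary mY iY hq hqr₁ hr₁' gY M N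
  obtain ⟨SZ1, -, SZ3⟩ := lastPassage_stationary mZ iZ hq hr₂ hr₂1 gZ M N
  obtain ⟨A1, A2, A3⟩ := sum_horizontal mX iX ⟨hr0, hr⟩ gX K
  obtain ⟨B1, B2, B3⟩ := sum_vertical mX iX hq hqr gX K
  obtain ⟨C1, -, C3⟩ := sum_horizontal mY iY ⟨hr₁0, hr₁'⟩ gY K
  obtain ⟨D1, -, D3⟩ := sum_vertical mZ iZ hq hr₂ gZ K
  have key : ∀ ω, _ := fun ω => lastPassage_le_max (x := fun x => stationaryWeight q r x ω)
    (y := fun x => stationaryWeight q r₁ x ω) (z := fun x => stationaryWeight q r₂ x ω) K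
    (fun i => by
      have h0 := stationaryParam_mem hq hqr hr (i, 0)
      have h1 := stationaryParam_mem hq hqr₁ hr₁' (i, 0)
      refine geomQuantile_mono h0.1.le ?_ h1.2 _
      simp only [stationaryParam, if_true]
      split_ifs <;> linarith)
    (fun j => by
      have h0 := stationaryParam_mem hq hqr hr (0, j)
      have h1 := stationaryParam_mem hq hr₂ hr₂1 (0, j)
      refine geomQuantile_mono h0.1.le ?_ h1.2 _
      simp only [stationaryParam, if_true]
      split_ifs
      · linarith
      · exact div_le_div_of_nonneg_left hq.le hr₂0 hr₂'.le)
    (fun i j => by simp [stationaryWeight, stationaryParam])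
    (fun i j => by simp [stationaryWeight, stationaryParam]) M N
  simp only [Finset.sum_sub_distrib] at key
  set a := r / (1 - r)
  set b := q / (r - q)
  set a₁ := r₁ / (1 - r₁)
  set b₁ := q / (r₁ - q)
  set a₂ := r₂ / (1 - r₂)
  set b₂ := q / (r₂ - q)
  set m := M * a + N * b
  set m₁ := M * a₁ + N * b₁
  set m₂ := M * a₂ + N * b₂
  have hm : 0 ≤ m := by
    have : 0 ≤ a := div_nonneg hr0.le (by linarith)
    have : 0 ≤ b := div_nonneg hq.le (by linarith)
    positivity
  set G : (ℕ × ℕ → ℝ) → ℝ := fun ω =>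
    (lastPassage (interiorWeight fun x => stationaryWeight q r x ω) M N : ℝ)
  set SX : (ℕ × ℕ → ℝ) → ℝ := fun ω => (lastPassage (fun x => stationaryWeight q r x ω) M N : ℝ)
  set SY : (ℕ × ℕ → ℝ) → ℝ := fun ω => (lastPassage (fun x => stationaryWeight q r₁ x ω) M N : ℝ)
  set SZ : (ℕ × ℕ → ℝ) → ℝ := fun ω => (lastPassage (fun x => stationaryWeight q r₂ x ω) M N : ℝ)
  set A : (ℕ × ℕ → ℝ) → ℝ := fun ω =>
    ∑ k ∈ Finset.range K, (stationaryWeight q r (k + 1, 0) ω : ℝ)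
  set B : (ℕ × ℕ → ℝ) → ℝ := fun ω =>
    ∑ k ∈ Finset.range K, (stationaryWeight q r (0, k + 1) ω : ℝ)
  set C : (ℕ × ℕ → ℝ) → ℝ := fun ω =>
    ∑ k ∈ Finset.range K, (stationaryWeight q r₁ (k + 1, 0) ω : ℝ)
  set D : (ℕ × ℕ → ℝ) → ℝ := fun ω =>
    ∑ k ∈ Finset.range K, (stationaryWeight q r₂ (0, k + 1) ω : ℝ)
  have key' : ∀ ω, SX ω ≤ max (G ω + (A ω + B ω))
    (max (SY ω - (C ω - A ω)) (SZ ω - (D ω - B ω))) := key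
  have habs : ∀ {f : (ℕ × ℕ → ℝ) → ℝ} (c : ℝ), Integrable f siteMeasure →
    Integrable (fun ω => |f ω - c|) siteMeasure := fun c hf => (hf.sub (integrable_const c)).abs
  set E : (ℕ × ℕ → ℝ) → ℝ := fun ω => |SX ω - m| + |SY ω - m₁| + |SZ ω - m₂| + |A ω - K * a|
    + |B ω - K * b| + |C ω - K * a₁| + |D ω - K * b₂|
  have iE : Integrable E siteMeasure :=
    ((((((habs m SX1).add (habs m₁ SY1)).add (habs m₂ SZ1)).add (habs _ A1)).add (habs _ B1)).add
      (habs _ C1)).add (habs _ D1)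
  have hmain : ∀ ω, SX ω ≤ G ω + (A ω + B ω) + (1 + m / Δ) * E ω := by
    intro ω
    exact le_add_mul_of_le_max hΔ hm (by positivity) (by positivity) (by positivity) (key' ω) h₁ h₂
  have hEint : ∫ ω, E ω ∂siteMeasure ≤ √M * (2 * (√(geomVar r)
          + √(geomVar (q / r)) + √(geomVar r₁) + √(geomVar (q / r₁)) + √(geomVar r₂)
          + √(geomVar (q / r₂)))) := by
    have hsq : ∀ {n : ℕ} (v : ℝ), n ≤ M → √(n * v) ≤ √M * √v := by
      intro n v hn
      rw [Real.sqrt_mul (by positivity)]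
      gcongr
    have hsum : ∫ ω, E ω ∂siteMeasure = ∫ ω, |SX ω - m| ∂siteMeasure + ∫ ω, |SY ω - m₁| ∂siteMeasure
        + ∫ ω, |SZ ω - m₂| ∂siteMeasure + ∫ ω, |A ω - K * a| ∂siteMeasure
        + ∫ ω, |B ω - K * b| ∂siteMeasure + ∫ ω, |C ω - K * a₁| ∂siteMeasure
        + ∫ ω, |D ω - K * b₂| ∂siteMeasure := by
      have j1 := (habs m SX1).add (habs m₁ SY1)
      have j2 := j1.add (habs m₂ SZ1)
      have j3 := j2.add (habs (K * a) A1)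
      have j4 := j3.add (habs (K * b) B1)
      have j5 := j4.add (habs (K * a₁) C1)
      have := integral_add' j5 (habs (K * b₂) D1)
      rw [integral_add' j4 (habs (K * a₁) C1), integral_add' j3 (habs (K * b) B1),
        integral_add' j2 (habs (K * a) A1), integral_add' j1 (habs m₂ SZ1),
        integral_add' (habs m SX1) (habs m₁ SY1)] at this
      exact this
    rw [hsum]
    have s1 := hsq (geomVar r) le_rfl
    have s2 := hsq (geomVar (q / r)) hNM
    have s3 := hsq (geomVar r₁) le_rfl
    have s4 := hsq (geomVar (q / r₁)) hNM
    have s5 := hsq (geomVar r₂) le_rfl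
    have s6 := hsq (geomVar (q / r₂)) hNM
    have s7 := hsq (geomVar r) hKM
    have s8 := hsq (geomVar (q / r)) hKM
    have s9 := hsq (geomVar r₁) hKM
    have s10 := hsq (geomVar (q / r₂)) hKM
    have n1 : 0 ≤ √M * √(geomVar (q / r₁)) := by positivity
    have n2 : 0 ≤ √M * √(geomVar r₂) := by positivity
    exact add_le_of_sqrt_bounds SX3 SY3 SZ3 A3 B3 C3 D3 s1 s2 s3 s4 s5 s6 s7 s8 s9 s10 n1 n2
  have hAB : Integrable (fun ω => A ω + B ω) siteMeasure := A1.add B1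
  have hGAB : Integrable (fun ω => G ω + (A ω + B ω)) siteMeasure := IX.add hAB
  calc m = ∫ ω, SX ω ∂siteMeasure := SX2.symm
    _ ≤ ∫ ω, (G ω + (A ω + B ω) + (1 + m / Δ) * E ω) ∂siteMeasure :=
        integral_mono SX1 (hGAB.add (iE.const_mul _)) hmain
    _ = ∫ ω, G ω ∂siteMeasure + K * (a + b) + (1 + m / Δ) * ∫ ω, E ω ∂siteMeasure := by
        rw [integral_add hGAB (iE.const_mul _), integral_add IX hAB, integral_add A1 B1, A2, B2,
          integral_const_mul, mul_add (K : ℝ)]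
    _ ≤ _ := by gcongr

end Bounds

/-! ### Asymptotics -/

section Asymptotics

lemma exists_div_mul_sub_lt_div_mul_add {u v x y : ℝ} (hx : 0 < x) (hy : 0 < y)
    (h : u / (x * x) < v / (y * y)) :
    ∃ t ∈ Set.Ioo 0 x, u / (x * (x - t)) < v / (y * (y + t)) := by
  have c₁ : ContinuousAt (fun t : ℝ => u / (x * (x - t))) 0 :=
    continuousAt_const.div (by fun_prop) (by simpa using hx.ne')
  have c₂ : ContinuousAt (fun t : ℝ => v / (y * (y + t))) 0 :=
    continuousAt_const.div (by fun_prop) (by simpa using hy.ne')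
  have h₁ : ∀ᶠ t in nhdsWithin (0 : ℝ) (Set.Ioi 0), u / (x * (x - t)) < v / (y * (y + t)) :=
    (c₁.eventually_lt c₂ (by simpa using h)).filter_mono nhdsWithin_le_nhds
  obtain ⟨t, ht, ht'⟩ := (h₁.and (Ioo_mem_nhdsGT hx)).exists
  exact ⟨t, ht', ht⟩

variable {q r γ : ℝ}

/-- At the critical parameter, moving the parameter up decreases the mean of the stationary model
to first order, once a small part of the horizontal boundary is discarded. -/
lemma exists_gt_stationaryMean_lt (hqr : q < r) (hr : r < 1)
    (hcrit : γ / (1 - r) ^ 2 = q / (r - q) ^ 2) {ε : ℝ} (hε : 0 < ε) :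
    ∃ r₁ ∈ Set.Ioo r 1, 0 < r₁ / (1 - r₁) - r / (1 - r) ∧
      (γ - ε) * (r₁ / (1 - r₁) - r / (1 - r)) < q / (r - q) - q / (r₁ - q) := by
  have hx : 0 < 1 - r := by linarith
  have hy : 0 < r - q := by linarith
  obtain ⟨t, ⟨ht0, ht1⟩, ht⟩ := exists_div_mul_sub_lt_div_mul_add (u := γ - ε) (v := q) hx hy (by
    rw [← sq, ← sq, ← hcrit]
    gcongr
    linarith)
  have hxt : 0 < 1 - r - t := by linarith
  have hyt : 0 < r - q + t := by linarith
  have hxt' : 1 - (r + t) ≠ 0 := by linarith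
  have hyt' : r + t - q ≠ 0 := by linarith
  have ea : (r + t) / (1 - (r + t)) - r / (1 - r) = t / ((1 - r) * (1 - r - t)) := by
    field_simp
    ring
  have eb : q / (r - q) - q / (r + t - q) = t * (q / ((r - q) * (r - q + t))) := by
    field_simp
    ring
  refine ⟨r + t, ⟨by linarith, by linarith⟩, ?_, ?_⟩
  · rw [ea]
    positivity
  · rw [ea, eb, mul_div_assoc', mul_comm (γ - ε), ← mul_div_assoc']
    exact mul_lt_mul_of_pos_left ht ht0

/-- At the critical parameter, moving the parameter down decreases the mean of the stationary model
to first order, once a small part of the vertical boundary is discarded. -/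
lemma exists_lt_stationaryMean_lt (hq : 0 < q) (hqr : q < r) (hr : r < 1)
    (hcrit : γ / (1 - r) ^ 2 = q / (r - q) ^ 2) {ε : ℝ} (hε : 0 < ε) :
    ∃ r₂ ∈ Set.Ioo q r, 0 < q / (r₂ - q) - q / (r - q) ∧
      0 < r / (1 - r) - r₂ / (1 - r₂) ∧
      (1 - ε) * (q / (r₂ - q) - q / (r - q)) < γ * (r / (1 - r) - r₂ / (1 - r₂)) := by
  have hx : 0 < 1 - r := by linarith
  have hy : 0 < r - q := by linarith
  obtain ⟨t, ⟨ht0, ht1⟩, ht⟩ := exists_div_mul_sub_lt_div_mul_add (u := (1 - ε) * q) (v := γ) hy hx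
    (by
      rw [← sq, ← sq, hcrit]
      gcongr
      nlinarith)
  have hxt : 0 < 1 - r + t := by linarith
  have hyt : 0 < r - q - t := by linarith
  have hxt' : 1 - (r - t) ≠ 0 := by linarith
  have hyt' : r - t - q ≠ 0 := by linarith
  have ea : r / (1 - r) - (r - t) / (1 - (r - t)) = t / ((1 - r) * (1 - r + t)) := by
    field_simp
    ring
  have eb : q / (r - t - q) - q / (r - q) = t * q / ((r - q) * (r - q - t)) := by
    field_simp
    ring
  refine ⟨r - t, ⟨by linarith, by linarith⟩, ?_, ?_, ?_⟩
  · rw [eb]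
    positivity
  · rw [ea]
    positivity
  · rw [ea, eb]
    calc (1 - ε) * (t * q / ((r - q) * (r - q - t)))
        = t * ((1 - ε) * q / ((r - q) * (r - q - t))) := by ring
      _ < t * (γ / ((1 - r) * (1 - r + t))) := mul_lt_mul_of_pos_left ht ht0
      _ = _ := by ring

lemma eventually_add_mul_sqrt_le (c d : ℝ) {ε : ℝ} (hε : 0 < ε) :
    ∀ᶠ N : ℕ in atTop, c + d * √N ≤ ε * N := by
  have h : Tendsto (fun N : ℕ => √(N : ℝ)) atTop atTop :=
    Real.tendsto_sqrt_atTop.comp tendsto_natCast_atTop_atTop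
  filter_upwards [h.eventually_ge_atTop 1, h.eventually_ge_atTop ((|c| + d) / ε)] with N h1 h2
  rw [div_le_iff₀ hε] at h2
  have h3 : √(N : ℝ) * √N = N := Real.mul_self_sqrt (by positivity)
  have h4 := le_abs_self c
  have h5 := abs_nonneg c
  nlinarith

lemma horizontal_gap {M N K γ ε δ a b a₁ b₁ : ℝ} (hN : 0 < N) (ha₁ : 0 < a₁ - a)
    (hM : M ≤ γ * N) (hK : ε * N ≤ K) (hδ : δ ≤ b - b₁ - (γ - ε) * (a₁ - a)) :
    M * a₁ + N * b₁ - K * (a₁ - a) ≤ M * a + N * b - δ * N := by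
  have h₁ : (M - K) * (a₁ - a) ≤ (γ - ε) * N * (a₁ - a) :=
    mul_le_mul_of_nonneg_right (by linarith) ha₁.le
  have h₂ := mul_le_mul_of_nonneg_right hδ hN.le
  linarith

lemma vertical_gap {M N K γ ε δ a b a₂ b₂ : ℝ} (hN : 0 < N) (ha₂ : 0 < a - a₂)
    (hb₂ : 0 < b₂ - b) (hM : γ * N < M + 1) (hK : ε * N ≤ K)
    (hδ : δ ≤ (γ * (a - a₂) - (1 - ε) * (b₂ - b)) / 2) (hNδ : a - a₂ ≤ δ * N) :
    M * a₂ + N * b₂ - K * (b₂ - b) ≤ M * a + N * b - δ * N := by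
  have h₁ : (γ * N - 1) * (a - a₂) ≤ M * (a - a₂) :=
    mul_le_mul_of_nonneg_right (by linarith) ha₂.le
  have h₂ : (N - K) * (b₂ - b) ≤ (1 - ε) * N * (b₂ - b) :=
    mul_le_mul_of_nonneg_right (by linarith) hb₂.le
  have h₃ := mul_le_mul_of_nonneg_right hδ hN.le
  linarith

lemma le_of_stationary_bound {M N K γ ε δ a b C I : ℝ} (hN : 0 < N) (ha : 0 ≤ a) (hb : 0 ≤ b)
    (hC : 0 ≤ C) (hδ : 0 < δ) (hγ : 0 < γ) (hM : M ≤ γ * N) (hM' : γ * N < M + 1)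
    (hK : K < ε * N + 1)
    (hε : 2 * a + b + (1 + (γ * a + b) / δ) * (√γ * C) * √N ≤ ε * N)
    (h : M * a + N * b ≤
      I + K * (a + b) + (1 + (M * a + N * b) / (δ * N)) * (√M * C)) :
    N * (γ * a + b) - N * (ε * (a + b + 1)) ≤ I := by
  have h₁ : M * a ≤ γ * N * a := mul_le_mul_of_nonneg_right hM ha
  have h₂ : (γ * N - 1) * a ≤ M * a := mul_le_mul_of_nonneg_right (by linarith) ha
  have hdiv : (M * a + N * b) / (δ * N) ≤ (γ * a + b) / δ := by
    rw [← mul_div_mul_right (γ * a + b) δ hN.ne']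
    gcongr
    linarith
  have hsqrt : √M ≤ √γ * √N := by
    rw [← Real.sqrt_mul hγ.le]
    exact Real.sqrt_le_sqrt hM
  have herr : (1 + (M * a + N * b) / (δ * N)) * (√M * C) ≤
      (1 + (γ * a + b) / δ) * (√γ * C) * √N := by
    calc (1 + (M * a + N * b) / (δ * N)) * (√M * C)
        ≤ (1 + (γ * a + b) / δ) * (√γ * √N * C) := by gcongr
      _ = _ := by ring
  have hKab : K * (a + b) ≤ (ε * N + 1) * (a + b) :=
    mul_le_mul_of_nonneg_right hK.le (by positivity)
  linarith

lemma eventually_le_integral_lastPassage (hq : 0 < q) (hqr : q < r) (hr : r < 1) (hγ : 1 ≤ γ)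
    (hcrit : γ / (1 - r) ^ 2 = q / (r - q) ^ 2) {ε : ℝ} (hε : 0 < ε) (hε1 : ε < 1) :
    ∀ᶠ N : ℕ in atTop, N * (γ * (r / (1 - r)) + q / (r - q))
        - N * (ε * (r / (1 - r) + q / (r - q) + 1)) ≤
      ∫ ω, (lastPassage (interiorWeight fun x => stationaryWeight q r x ω) ⌊γ * N⌋₊ N : ℝ)
        ∂siteMeasure := by
  obtain ⟨r₁, ⟨hr₁, hr₁'⟩, ha₁, hd₁⟩ := exists_gt_stationaryMean_lt hqr hr hcrit hε
  obtain ⟨r₂, ⟨hr₂, hr₂'⟩, hb₂, ha₂, hd₂⟩ := exists_lt_stationaryMean_lt hq hqr hr hcrit hε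
  have key := fun M N K Δ => le_integral_lastPassage_interiorWeight hq hqr hr hr₁ hr₁' hr₂ hr₂'
    (M := M) (N := N) (K := K) (Δ := Δ)
  have ha : 0 ≤ r / (1 - r) := div_nonneg (hq.trans hqr).le (by linarith)
  have hb : 0 ≤ q / (r - q) := div_nonneg hq.le (by linarith)
  have hC : 0 ≤ 2 * (√(geomVar r) + √(geomVar (q / r)) + √(geomVar r₁) + √(geomVar (q / r₁))
    + √(geomVar r₂) + √(geomVar (q / r₂))) := by positivity
  generalize 2 * (√(geomVar r) + √(geomVar (q / r)) + √(geomVar r₁) + √(geomVar (q / r₁))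
    + √(geomVar r₂) + √(geomVar (q / r₂))) = C at key hC
  generalize r / (1 - r) = a at *
  generalize q / (r - q) = b at *
  generalize r₁ / (1 - r₁) = a₁ at *
  generalize q / (r₁ - q) = b₁ at *
  generalize r₂ / (1 - r₂) = a₂ at *
  generalize q / (r₂ - q) = b₂ at *
  obtain ⟨δ, hδ, hδ₁₂⟩ := exists_between (lt_min (sub_pos.2 hd₁) (half_pos (sub_pos.2 hd₂)))
  have hδ₁ := hδ₁₂.le.trans (min_le_left _ _)
  have hδ₂ := hδ₁₂.le.trans (min_le_right _ _)
  filter_upwards [eventually_add_mul_sqrt_le (a - a₂) 0 hδ, eventually_gt_atTop 0,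
    eventually_add_mul_sqrt_le (2 * a + b) ((1 + (γ * a + b) / δ) * (√γ * C)) hε] with N e1 hN e2
  have hN0 : (0 : ℝ) < N := by exact_mod_cast hN
  have hM : (⌊γ * N⌋₊ : ℝ) ≤ γ * N := Nat.floor_le (by positivity)
  have hM' : γ * N < ⌊γ * N⌋₊ + 1 := Nat.lt_floor_add_one _
  have hNM : N ≤ ⌊γ * N⌋₊ := Nat.le_floor (le_mul_of_one_le_left hN0.le hγ)
  have hK : ε * N ≤ ⌈ε * N⌉₊ := Nat.le_ceil _
  have hK' : (⌈ε * N⌉₊ : ℝ) < ε * N + 1 := Nat.ceil_lt_add_one (by positivity)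
  have hKM : ⌈ε * N⌉₊ ≤ ⌊γ * N⌋₊ :=
    (Nat.ceil_le.2 (mul_le_of_le_one_left hN0.le hε1.le)).trans hNM
  have h := key ⌊γ * N⌋₊ N ⌈ε * N⌉₊ (δ * N) (by positivity) hNM hKM
  generalize (⌊γ * N⌋₊ : ℝ) = M at *
  generalize (⌈ε * N⌉₊ : ℝ) = K at *
  exact le_of_stationary_bound hN0 ha hb hC hδ (zero_lt_one.trans_le hγ) hM hM' hK' e2
    (h (horizontal_gap hN0 ha₁ hM hK hδ₁)
      (vertical_gap hN0 ha₂ hb₂ hM' hK hδ₂ (by linarith)))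

lemma tendsto_integral_lastPassage (hq : 0 < q) (hqr : q < r) (hr : r < 1) (hγ : 1 ≤ γ)
    (hcrit : γ / (1 - r) ^ 2 = q / (r - q) ^ 2) :
    Tendsto (fun N : ℕ => (1 / (N : ℝ)) *
      ∫ ω, (lastPassage (interiorWeight fun x => stationaryWeight q r x ω) ⌊γ * N⌋₊ N : ℝ)
        ∂siteMeasure) atTop (nhds (γ * (r / (1 - r)) + q / (r - q))) := by
  have ha : 0 ≤ r / (1 - r) := div_nonneg (hq.trans hqr).le (by linarith)
  have hb : 0 ≤ q / (r - q) := div_nonneg hq.le (by linarith)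
  set c := r / (1 - r) + q / (r - q) + 1
  have hc : 0 < c := by positivity
  rw [tendsto_order]
  constructor
  · intro x hx
    set φ := γ * (r / (1 - r)) + q / (r - q)
    obtain ⟨ε, hε, hεx⟩ := exists_between (lt_min one_pos (div_pos (sub_pos.2 hx) hc))
    filter_upwards [eventually_le_integral_lastPassage hq hqr hr hγ hcrit hε
      (hεx.trans_le (min_le_left _ _)), eventually_gt_atTop 0] with N h hN
    have hN0 : (0 : ℝ) < N := by exact_mod_cast hN
    rw [one_div_mul_eq_div, lt_div_iff₀ hN0]
    refine lt_of_lt_of_le ?_ h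
    have := (lt_div_iff₀ hc).1 (hεx.trans_le (min_le_right _ _))
    nlinarith
  · intro x hx
    filter_upwards [eventually_gt_atTop 0] with N hN
    have hN0 : (0 : ℝ) < N := by exact_mod_cast hN
    rw [one_div_mul_eq_div, div_lt_iff₀ hN0]
    refine (integral_lastPassage_interiorWeight_le hq hqr hr _ N).trans_lt ?_
    have := mul_le_mul_of_nonneg_right (Nat.floor_le (show 0 ≤ γ * N by positivity)) ha
    nlinarith

end Asymptotics

end LastPassagePercolation

/-- For each `q ∈ (0,1)` and `γ ≥ 1`,
`lim_{N→∞} (1/N) 𝔼[G(⌊γN⌋, N)] = (1+√(qγ))²/(1−q) − 1`. -/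
theorem stmt0
    {Ω : Type*} [MeasurableSpace Ω] (ℙ : Measure Ω) [IsProbabilityMeasure ℙ]
    (q : ℝ) (hq0 : 0 < q) (hq1 : q < 1)
    (w : ℕ × ℕ → Ω → ℕ)
    (hmeas : ∀ p, Measurable (w p))
    (hindep : ProbabilityTheory.iIndepFun w ℙ)
    (hgeom : ∀ p k, ℙ {ω | w p ω = k} = ENNReal.ofReal ((1 - q) * q ^ k))
    (γ : ℝ) (hγ : 1 ≤ γ) :
    Tendsto
      (fun N : ℕ => (1 / (N : ℝ)) * ∫ ω, (lppSup (fun p => w p ω) ⌊γ * N⌋₊ N : ℝ) ∂ℙ)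
      atTop
      (nhds ((1 + Real.sqrt (q * γ)) ^ 2 / (1 - q) - 1)) := by
  rw [Real.sqrt_mul hq0.le]
  have hs : 0 < √q := Real.sqrt_pos.2 hq0
  have hg : 0 < √γ := Real.sqrt_pos.2 (by linarith)
  have hs2 : √q ^ 2 = q := Real.sq_sqrt hq0.le
  have hg2 : √γ ^ 2 = γ := Real.sq_sqrt (by linarith)
  generalize √q = s at *
  generalize √γ = g at *
  subst hs2 hg2
  have hs1 : 0 < 1 - s ^ 2 := by linarith
  have h1r : 1 - (s + s ^ 2 * g) / (g + s) = g * (1 - s ^ 2) / (g + s) := by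
    field_simp
    ring
  have hrq : (s + s ^ 2 * g) / (g + s) - s ^ 2 = s * (1 - s ^ 2) / (g + s) := by
    field_simp
    ring
  have hqr : s ^ 2 < (s + s ^ 2 * g) / (g + s) := by
    rw [← sub_pos, hrq]
    positivity
  have hr : (s + s ^ 2 * g) / (g + s) < 1 := by
    rw [← sub_pos, h1r]
    positivity
  have h := tendsto_integral_lastPassage hq0 hqr hr hγ (by
    rw [h1r, hrq]
    field_simp)
  have e : g ^ 2 * ((s + s ^ 2 * g) / (g + s) / (1 - (s + s ^ 2 * g) / (g + s))) +
      s ^ 2 / ((s + s ^ 2 * g) / (g + s) - s ^ 2) = (1 + s * g) ^ 2 / (1 - s ^ 2) - 1 := by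
    rw [h1r, hrq]
    field_simp
    ring
  rw [e] at h
  refine h.congr' ?_
  filter_upwards [eventually_ge_atTop 1] with N hN
  have hM : 1 ≤ ⌊g ^ 2 * N⌋₊ := Nat.le_floor (by
    have : (1 : ℝ) ≤ N := by exact_mod_cast hN
    push_cast
    nlinarith)
  rw [integral_lppSup_eq hq0 hqr hr hmeas hindep (fun p k => hgeom p k) hM hN]
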